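/- Let d ≥ 1, k ≥ 1 be fixed integers, s ∈ (0,2] and L > 0. There exists a constant C depending only on s, L, d and k such that for every n ≥ k and every probability density f in the Hölder ball H^s_d(L;[0,1]^d), if X, X_1,…,X_n are i.i.d. samples from f and R_k(X) denotes the k-th smallest torus distance from X to X_1,…,X_n, then E[ ln( f_{R_k(X)}(X) / f(X) ) ] ≤ C n^{−s/(s+d)} (the expectation being over both X and the sample, and well-defined since f(X) > 0 almost surely). -/

import Mathlib

open MeasureTheory Real

noncomputable section

abbrev Euc (d : ℕ) : Type := EuclideanSpace ℝ (Fin d)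

/-- The unit cube `[0,1]^d`. -/
def unitCube (d : ℕ) : Set (Euc d) := {x | ∀ i, x i ∈ Set.Icc (0:ℝ) 1}

/-- Volume of the unit Euclidean ball in `ℝ^d`. -/
def unitBallVol (d : ℕ) : ℝ := Real.pi ^ ((d : ℝ) / 2) / Real.Gamma (1 + (d : ℝ) / 2)

/-- The point of `ℝ^d` with integer coordinates `m`. -/
def intVec (d : ℕ) (m : Fin d → ℤ) : Euc d :=
  (WithLp.equiv 2 (Fin d → ℝ)).symm fun i => (m i : ℝ)

/-- Torus distance: `d(x,y) = min_{m ∈ ℤ^d} ‖x + m - y‖`. -/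
def torusDist (d : ℕ) (x y : Euc d) : ℝ :=
  ⨅ m : Fin d → ℤ, ‖x + intVec d m - y‖

/-- `(s,L)`-Hölder condition for `s ∈ (0,2]`. -/
def IsHolderOrder (d : ℕ) (s L : ℝ) (f : Euc d → ℝ) : Prop :=
  if s ≤ 1 then
    ∀ x y : Euc d, |f x - f y| ≤ L * ‖x - y‖ ^ s
  else
    ContDiff ℝ 1 f ∧ ∀ x y : Euc d, ‖gradient f x - gradient f y‖ ≤ L * ‖x - y‖ ^ (s - 1)

/-- `f` is 1-periodic in each coordinate. -/
def IsPeriodic (d : ℕ) (f : Euc d → ℝ) : Prop :=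
  ∀ (x : Euc d) (i : Fin d), f (x + EuclideanSpace.single i 1) = f x

/-- Probability density in the Hölder ball `H^s_d(L;[0,1]^d)`, represented by its
1-periodic extension to `ℝ^d`. -/
def HolderDensity (d : ℕ) (s L : ℝ) (f : Euc d → ℝ) : Prop :=
  IsHolderOrder d s L f ∧ IsPeriodic d f ∧ (∀ x, 0 ≤ f x) ∧
    (∫ x in unitCube d, f x) = 1

/-- The probability measure on `[0,1]^d` with density `f`. -/
def densityMeasure (d : ℕ) (f : Euc d → ℝ) : Measure (Euc d) :=
  (volume.restrict (unitCube d)).withDensity fun x => ENNReal.ofReal (f x)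

/-- Law of `n` i.i.d. samples from density `f`. -/
def sampleMeasure (d n : ℕ) (f : Euc d → ℝ) : Measure (Fin n → Euc d) :=
  Measure.pi fun _ => densityMeasure d f

/-- The `k`-th smallest element (1-indexed) of a multiset of reals. -/
def kthSmallest (s : Multiset ℝ) (k : ℕ) : ℝ :=
  (s.sort (· ≤ ·)).getD (k - 1) 0

/-- `R_{i,k}`: the `k`-nearest neighbor torus distance from `X i` to the other points. -/
def nnDist (d n : ℕ) (X : Fin n → Euc d) (i : Fin n) (k : ℕ) : ℝ :=
  kthSmallest ((Finset.univ.erase i).val.map fun j => torusDist d (X i) (X j)) k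

/-- The digamma function: derivative of `ln Γ`. -/
def digamma (x : ℝ) : ℝ := deriv (fun y => Real.log (Real.Gamma y)) x

/-- The Kozachenko–Leonenko `k`-nearest neighbor differential entropy estimator. -/
def klEstimator (d k n : ℕ) (X : Fin n → Euc d) : ℝ :=
  Real.log k - digamma k +
    (1 / n : ℝ) * ∑ i : Fin n, Real.log ((n / k : ℝ) * (unitBallVol d * nnDist d n X i k ^ d))

/-- Differential entropy `h(f) = -∫_{[0,1]^d} f ln f`. -/
def diffEntropy (d : ℕ) (f : Euc d → ℝ) : ℝ :=
  -∫ x in unitCube d, f x * Real.log (f x)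

end

noncomputable section

/-- `f_t(x)`: the average of `f` over the closed Euclidean ball `B(x,t)`,
`f_t(x) = (1/(V_d t^d)) ∫_{‖u-x‖ ≤ t} f(u) du`. -/
def ballAvg (d : ℕ) (f : Euc d → ℝ) (t : ℝ) (x : Euc d) : ℝ :=
  (1 / (unitBallVol d * t ^ d)) * ∫ u in Metric.closedBall x t, f u

/-- `R_k(x)`: the `k`-th smallest torus distance from the point `x` to the sample points. -/
def RkOfPoint (d n k : ℕ) (x : Euc d) (X : Fin n → Euc d) : ℝ :=
  kthSmallest (Finset.univ.val.map fun j : Fin n => torusDist d x (X j)) k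

end

/-! ### Order statistics -/

lemma kthSmallest_mem {S : Multiset ℝ} {k : ℕ} (hk : 1 ≤ k) (hS : k ≤ S.card) :
    kthSmallest S k ∈ S := by
  have hlt : k - 1 < (S.sort (· ≤ ·)).length := by rw [Multiset.length_sort]; omega
  rw [kthSmallest, List.getD_eq_getElem _ _ hlt]
  exact (Multiset.mem_sort (r := (· ≤ ·))).1 (List.getElem_mem hlt)

/-- Fewer than `k` elements lie below a level smaller than the `k`-th smallest element. -/
lemma countP_le_lt_of_lt_kthSmallest {S : Multiset ℝ} {k : ℕ} (hk : 1 ≤ k) (hS : k ≤ S.card)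
    {t : ℝ} (ht : t < kthSmallest S k) : S.countP (· ≤ t) < k := by
  set l := S.sort (· ≤ ·) with hl
  have hlt : k - 1 < l.length := by rw [hl, Multiset.length_sort]; omega
  have hsort : l.Pairwise (· ≤ ·) := Multiset.pairwise_sort S (· ≤ ·)
  rw [kthSmallest, List.getD_eq_getElem _ _ hlt] at ht
  have hdrop : (l.drop (k - 1)).countP (· ≤ t) = 0 := by
    rw [List.countP_eq_zero]
    intro a ha
    obtain ⟨i, hi, rfl⟩ := List.mem_iff_getElem.1 ha
    rw [List.length_drop] at hi
    have hle : l[k - 1] ≤ l[k - 1 + i] := hsort.rel_get_of_le (a := ⟨k - 1, hlt⟩)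
      (b := ⟨k - 1 + i, by omega⟩) (by simp)
    simpa using ht.trans_le hle
  have hcount : S.countP (· ≤ t) = l.countP (· ≤ t) := by
    rw [← Multiset.sort_eq S (· ≤ ·), Multiset.coe_countP]
  have htake : (l.take (k - 1)).countP (· ≤ t) ≤ k - 1 :=
    List.countP_le_length.trans (List.length_take_le _ _)
  rw [hcount, ← List.take_append_drop (k - 1) l, List.countP_append, hdrop]
  omega

/-- At most `k` indices `i` have fewer than `k` other values `a j ≤ a i`. -/
lemma card_filter_few_le {n k : ℕ} (a : Fin (n + 1) → ℝ) :
    (Finset.univ.filter fun i : Fin (n + 1) =>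
      (Finset.univ.filter fun j : Fin n => a (i.succAbove j) ≤ a i).card < k).card ≤ k := by
  set T := Finset.univ.filter fun i : Fin (n + 1) =>
    (Finset.univ.filter fun j : Fin n => a (i.succAbove j) ≤ a i).card < k with hT
  rcases T.eq_empty_or_nonempty with h | h
  · simp [h]
  obtain ⟨i, hi, hmax⟩ := T.exists_max_image a h
  have hlt := (Finset.mem_filter.1 hi).2
  have hsub : T.erase i ⊆
      (Finset.univ.filter fun j : Fin n => a (i.succAbove j) ≤ a i).map
        i.succAboveEmb := by
    intro j hj
    obtain ⟨hne, hjT⟩ := Finset.mem_erase.1 hj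
    obtain ⟨m, rfl⟩ := Fin.exists_succAbove_eq hne
    exact Finset.mem_map.2 ⟨m, by simpa using hmax _ hjT, rfl⟩
  have := Finset.card_le_card hsub
  rw [Finset.card_map, Finset.card_erase_of_mem hi] at this
  omega

lemma measurableSet_few {α : Type*} [MeasurableSpace α] {δ : α → ℝ} (hδ : Measurable δ)
    (n k : ℕ) : MeasurableSet {z : α × (Fin n → α) |
      (Finset.univ.filter fun j : Fin n => δ (z.2 j) ≤ δ z.1).card < k} := by
  have hm : Measurable fun z : α × (Fin n → α) =>
      (Finset.univ.filter fun j : Fin n => δ (z.2 j) ≤ δ z.1).card := by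
    simp only [Finset.card_filter]
    refine Finset.measurable_sum _ fun j _ => Measurable.ite ?_ measurable_const measurable_const
    exact measurableSet_le (hδ.comp ((measurable_pi_apply j).comp measurable_snd))
      (hδ.comp measurable_fst)
  exact hm (measurableSet_Iio (a := k))

/-- The probability that a fresh sample lands among the lowest `k` of `n + 1` i.i.d. scores. -/
lemma prod_pi_few_le {α : Type*} [MeasurableSpace α] (ν : Measure α) [IsProbabilityMeasure ν]
    {δ : α → ℝ} (hδ : Measurable δ) (n k : ℕ) :
    ((n : ENNReal) + 1) * (ν.prod (Measure.pi fun _ : Fin n => ν))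
      {z | (Finset.univ.filter fun j : Fin n => δ (z.2 j) ≤ δ z.1).card < k} ≤ k := by
  classical
  set S : Set (α × (Fin n → α)) :=
    {z | (Finset.univ.filter fun j : Fin n => δ (z.2 j) ≤ δ z.1).card < k} with hS
  have hSm : MeasurableSet S := measurableSet_few hδ n k
  let e (i : Fin (n + 1)) := MeasurableEquiv.piFinSuccAbove (fun _ : Fin (n + 1) => α) i
  have he (i : Fin (n + 1)) : MeasurePreserving (e i) (Measure.pi fun _ => ν)
      (ν.prod (Measure.pi fun _ : Fin n => ν)) :=
    measurePreserving_piFinSuccAbove (fun _ => ν) i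
  calc ((n : ENNReal) + 1) * (ν.prod (Measure.pi fun _ : Fin n => ν)) S
      = ∑ i : Fin (n + 1), (Measure.pi fun _ : Fin (n + 1) => ν) (e i ⁻¹' S) := by
        simp [(he _).measure_preimage hSm.nullMeasurableSet]
    _ = ∫⁻ Z, ∑ i : Fin (n + 1), (e i ⁻¹' S).indicator 1 Z
          ∂(Measure.pi fun _ : Fin (n + 1) => ν) := by
        rw [lintegral_finsetSum]
        · simp [lintegral_indicator_one ((e _).measurable hSm)]
        · exact fun i _ => measurable_one.indicator ((e i).measurable hSm)
    _ ≤ ∫⁻ _, (k : ENNReal) ∂(Measure.pi fun _ : Fin (n + 1) => ν) := by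
        refine lintegral_mono fun Z => ?_
        have h := card_filter_few_le (k := k) fun i => δ (Z i)
        simp only [Set.indicator_apply, Pi.one_apply, Finset.sum_boole]
        refine Nat.cast_le.2 (le_trans (le_of_eq ?_) h)
        congr!
    _ = k := by simp

/-! ### The torus distance -/

lemma torusDist_le (d : ℕ) (x y : Euc d) (m : Fin d → ℤ) :
    torusDist d x y ≤ ‖x + intVec d m - y‖ :=
  ciInf_le ⟨0, by rintro _ ⟨m, rfl⟩; positivity⟩ m

lemma torusDist_nonneg (d : ℕ) (x y : Euc d) : 0 ≤ torusDist d x y :=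
  le_ciInf fun _ => norm_nonneg _

lemma torusDist_le_dim (d : ℕ) (x y : Euc d) : torusDist d x y ≤ d := by
  refine (torusDist_le d x y fun i => ⌊y i - x i⌋).trans ?_
  rw [EuclideanSpace.norm_eq]
  refine Real.sqrt_le_iff.2 ⟨by positivity, ?_⟩
  calc ∑ i, ‖(x + intVec d (fun i => ⌊y i - x i⌋) - y) i‖ ^ 2 ≤ ∑ _i : Fin d, (1 : ℝ) := by
        refine Finset.sum_le_sum fun i _ => ?_
        have h1 := Int.floor_le (y i - x i)
        have h2 := Int.lt_floor_add_one (y i - x i)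
        have h3 : (x + intVec d (fun i => ⌊y i - x i⌋) - y) i = x i + ⌊y i - x i⌋ - y i := by
          simp [intVec]
        rw [h3, Real.norm_eq_abs, sq_abs]
        nlinarith
    _ = d := by simp
    _ ≤ (d : ℝ) ^ 2 := by exact_mod_cast Nat.le_self_pow two_ne_zero d

lemma measurable_torusDist (d : ℕ) (x : Euc d) : Measurable (torusDist d x) := by
  unfold torusDist
  exact Measurable.iInf fun m => (measurable_const.sub measurable_id).norm

lemma RkOfPoint_mem_Icc {d n k : ℕ} (hk : 1 ≤ k) (hkn : k ≤ n) (x : Euc d) (X : Fin n → Euc d) :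
    RkOfPoint d n k x X ∈ Set.Icc (0 : ℝ) d := by
  have h := kthSmallest_mem (S := Finset.univ.val.map fun j : Fin n => torusDist d x (X j)) hk
    (by simpa using hkn)
  obtain ⟨j, -, hj⟩ := Multiset.mem_map.1 h
  rw [RkOfPoint, ← hj]
  exact ⟨torusDist_nonneg _ _ _, torusDist_le_dim _ _ _⟩

/-- The mass strictly inside the `k`-nearest-neighbour ball is at most `k / n` on average. -/
lemma lintegral_measure_lt_RkOfPoint_le {d n k : ℕ} (hk : 1 ≤ k) (hkn : k ≤ n) (x : Euc d)
    (ν : Measure (Euc d)) [IsProbabilityMeasure ν] :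
    ∫⁻ X, ν {y | torusDist d x y < RkOfPoint d n k x X} ∂(Measure.pi fun _ : Fin n => ν)
      ≤ ENNReal.ofReal (k / n) := by
  have hn : (0 : ℝ) < n := by exact_mod_cast (by omega : 0 < n)
  have h := prod_pi_few_le ν (measurable_torusDist d x) n k
  set S : Set (Euc d × (Fin n → Euc d)) := {z | (Finset.univ.filter fun j : Fin n =>
    torusDist d x (z.2 j) ≤ torusDist d x z.1).card < k} with hS
  have hprod : (ν.prod (Measure.pi fun _ : Fin n => ν)) S ≤ ENNReal.ofReal (k / n) := by
    rw [ENNReal.ofReal_div_of_pos hn, ENNReal.ofReal_natCast, ENNReal.ofReal_natCast,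
      ENNReal.le_div_iff_mul_le (Or.inl (by exact_mod_cast hn.ne')) (Or.inl (by simp)), mul_comm]
    exact (mul_le_mul_left le_self_add _).trans h
  refine (?_ : _ ≤ ∫⁻ X, ν ((fun y => (y, X)) ⁻¹' S) ∂(Measure.pi fun _ : Fin n => ν)).trans ?_
  · refine lintegral_mono fun X => measure_mono fun y hy => ?_
    have := countP_le_lt_of_lt_kthSmallest hk (by simpa using hkn) hy
    rw [Multiset.countP_map] at this
    exact this
  · rwa [← Measure.prod_apply_symm (measurableSet_few (measurable_torusDist d x) n k)]

/-! ### Ball averages of Hölder functions -/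

lemma unitBallVol_pos (d : ℕ) : 0 < unitBallVol d :=
  div_pos (by positivity) (Real.Gamma_pos_of_pos (by positivity))

lemma volume_real_closedBall_eq {d : ℕ} (hd : 1 ≤ d) (x : Euc d) {R : ℝ} (hR : 0 ≤ R) :
    volume.real (Metric.closedBall x R) = unitBallVol d * R ^ d := by
  have : Nonempty (Fin d) := ⟨⟨0, hd⟩⟩
  have hpi : Real.pi ^ ((d : ℝ) / 2) = √Real.pi ^ d := by
    rw [Real.sqrt_eq_rpow, ← Real.rpow_natCast, ← Real.rpow_mul Real.pi_pos.le]
    ring_nf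
  have hvol : 0 ≤ √Real.pi ^ d / Real.Gamma ((d : ℝ) / 2 + 1) :=
    div_nonneg (by positivity) (Real.Gamma_nonneg_of_nonneg (by positivity))
  rw [Measure.real, EuclideanSpace.volume_closedBall, Fintype.card_fin, unitBallVol, hpi,
    ENNReal.toReal_mul, ENNReal.toReal_pow, ENNReal.toReal_ofReal hR, ENNReal.toReal_ofReal hvol,
    add_comm (1 : ℝ), mul_comm]

lemma IsHolderOrder.continuous {d : ℕ} {s L : ℝ} (hs : 0 < s) {f : Euc d → ℝ}
    (hf : IsHolderOrder d s L f) : Continuous f := by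
  unfold IsHolderOrder at hf
  split_ifs at hf with h
  · refine continuous_iff_continuousAt.2 fun x => ?_
    rw [ContinuousAt, tendsto_iff_dist_tendsto_zero]
    refine squeeze_zero (fun _ => dist_nonneg) (fun y => hf y x) ?_
    have hc : Continuous fun y : Euc d => L * ‖y - x‖ ^ s :=
      continuous_const.mul ((continuous_id.sub continuous_const).norm.rpow_const
        fun _ => Or.inr hs.le)
    simpa [Real.zero_rpow hs.ne'] using hc.tendsto x
  · exact hf.1.continuous

/-- A Hölder function of order `s ≤ 2` lies below an affine function up to `L R ^ s`. -/
lemma IsHolderOrder.exists_affine_bound {d : ℕ} {s L : ℝ} (hs : 0 < s) (hL : 0 < L)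
    {f : Euc d → ℝ} (hf : IsHolderOrder d s L f) (x : Euc d) {R : ℝ} (hR : 0 < R) :
    ∃ φ : Euc d →L[ℝ] ℝ, ∀ u ∈ Metric.closedBall x R, f u ≤ f x + φ (u - x) + L * R ^ s := by
  unfold IsHolderOrder at hf
  split_ifs at hf with h
  · refine ⟨0, fun u hu => ?_⟩
    have hu' : ‖u - x‖ ≤ R := by simpa [dist_eq_norm] using hu
    have h1 := (abs_le.1 (hf u x)).2
    have h2 : L * ‖u - x‖ ^ s ≤ L * R ^ s := by gcongr
    rw [zero_apply]
    linarith
  · refine ⟨fderiv ℝ f x, fun u hu => ?_⟩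
    have hu' : ‖u - x‖ ≤ R := by simpa [dist_eq_norm] using hu
    have hbound : ∀ y ∈ Metric.closedBall x R, ‖fderiv ℝ f y - fderiv ℝ f x‖ ≤ L * R ^ (s - 1) := by
      intro y hy
      have hy' : ‖y - x‖ ≤ R := by simpa [dist_eq_norm] using hy
      have hs1 : 0 ≤ s - 1 := by linarith
      calc ‖fderiv ℝ f y - fderiv ℝ f x‖ = ‖gradient f y - gradient f x‖ := by
            rw [gradient, gradient, ← map_sub, LinearIsometryEquiv.norm_map]
        _ ≤ L * ‖y - x‖ ^ (s - 1) := hf.2 y x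
        _ ≤ L * R ^ (s - 1) := by gcongr
    have h1 := (convex_closedBall x R).norm_image_sub_le_of_norm_fderiv_le'
      (fun y _ => (hf.1.differentiable one_ne_zero).differentiableAt) hbound
      (Metric.mem_closedBall_self hR.le) hu
    have h2 : L * R ^ (s - 1) * ‖u - x‖ ≤ L * R ^ s := by
      calc L * R ^ (s - 1) * ‖u - x‖ ≤ L * R ^ (s - 1) * R := by gcongr
        _ = L * R ^ s := by rw [mul_assoc, ← Real.rpow_add_one hR.ne', sub_add_cancel]
    have h3 := (abs_le.1 (Real.norm_eq_abs _ ▸ h1)).2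
    linarith

lemma setIntegral_closedBall_clm_sub {d : ℕ} (φ : Euc d →L[ℝ] ℝ) (x : Euc d) (R : ℝ) :
    ∫ u in Metric.closedBall x R, φ (u - x) = 0 := by
  classical
  set g : Euc d → ℝ := (Metric.closedBall (0 : Euc d) R).indicator fun h => φ h with hg
  have h1 : ∫ u in Metric.closedBall x R, φ (u - x) = ∫ h, g h := by
    rw [← integral_indicator Metric.isClosed_closedBall.measurableSet,
      ← integral_sub_right_eq_self g x]
    refine integral_congr_ae (ae_of_all _ fun u => ?_)
    simp [hg, Set.indicator_apply, dist_eq_norm]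
  have h2 : ∫ h, g h = -∫ h, g h := by
    rw [← integral_neg, ← integral_neg_eq_self]
    refine integral_congr_ae (ae_of_all _ fun u => ?_)
    simp only [hg, Set.indicator_apply, mem_closedBall_zero_iff, norm_neg, map_neg]
    split_ifs <;> simp
  linarith

lemma ballAvg_le {d : ℕ} (hd : 1 ≤ d) {s L : ℝ} (hs : 0 < s) (hL : 0 < L) {f : Euc d → ℝ}
    (hf : IsHolderOrder d s L f) (x : Euc d) {R : ℝ} (hR : 0 < R) :
    ballAvg d f R x ≤ f x + L * R ^ s := by
  obtain ⟨φ, hφ⟩ := hf.exists_affine_bound hs hL x hR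
  have hc := hf.continuous hs
  have hB : IsCompact (Metric.closedBall x R) := isCompact_closedBall x R
  have hφi : IntegrableOn (fun u => φ (u - x)) (Metric.closedBall x R) :=
    (by fun_prop : Continuous fun u => φ (u - x)).continuousOn.integrableOn_compact hB
  have hint : ∫ u in Metric.closedBall x R, f u ≤ unitBallVol d * R ^ d * (f x + L * R ^ s) := by
    calc ∫ u in Metric.closedBall x R, f u
        ≤ ∫ u in Metric.closedBall x R, (φ (u - x) + (f x + L * R ^ s)) := by
          refine setIntegral_mono_on (hc.continuousOn.integrableOn_compact hB)
            (hφi.add (integrableOn_const hB.measure_ne_top)) hB.measurableSet fun u hu => ?_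
          linarith [hφ u hu]
      _ = _ := by
          rw [integral_add hφi (integrableOn_const hB.measure_ne_top),
            setIntegral_closedBall_clm_sub, setIntegral_const, volume_real_closedBall_eq hd x hR.le]
          simp
  have hV := mul_pos (unitBallVol_pos d) (pow_pos hR d)
  rw [ballAvg, one_div, inv_mul_le_iff₀ hV]
  exact hint

/-! ### Periodic densities -/

lemma IsPeriodic.add_intVec {d : ℕ} {f : Euc d → ℝ} (hf : IsPeriodic d f) (x : Euc d)
    (m : Fin d → ℤ) : f (x + intVec d m) = f x := by
  have hint (i : Fin d) (x : Euc d) (a : ℤ) :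
      f (x + (a : ℝ) • EuclideanSpace.single i (1 : ℝ)) = f x := by
    have hp : Function.Periodic (fun t : ℝ => f (x + t • EuclideanSpace.single i (1 : ℝ))) 1 := by
      intro t
      have := hf (x + t • EuclideanSpace.single i (1 : ℝ)) i
      simpa [add_smul, add_assoc] using this
    simpa using hp.int_mul a 0
  have hsum : intVec d m = ∑ i, (m i : ℝ) • EuclideanSpace.single i (1 : ℝ) := by
    ext j
    simp [intVec, Pi.single_apply]
  rw [hsum]
  induction (Finset.univ : Finset (Fin d)) using Finset.induction_on generalizing x with
  | empty => simp
  | insert i t hi ih => rw [Finset.sum_insert hi, ← add_assoc, ih, hint]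

lemma measurableSet_unitCube (d : ℕ) : MeasurableSet (unitCube d) := by
  have : unitCube d = ⋂ i, {x : Euc d | x i ∈ Set.Icc (0 : ℝ) 1} := by
    ext x; simp [unitCube]
  rw [this]
  exact MeasurableSet.iInter fun i =>
    (by fun_prop : Measurable fun x : Euc d => x i) measurableSet_Icc

lemma volume_unitCube (d : ℕ) : volume (unitCube d) = 1 := by
  have hpre : unitCube d = WithLp.ofLp ⁻¹' Set.univ.pi fun _ : Fin d => Set.Icc (0 : ℝ) 1 := by
    ext x
    simp [unitCube, -Set.pi_univ_Icc]
  rw [hpre, (PiLp.volume_preserving_ofLp (Fin d)).measure_preimage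
    (MeasurableSet.univ_pi fun _ => measurableSet_Icc).nullMeasurableSet, volume_pi_pi]
  simp

lemma HolderDensity.isProbabilityMeasure {d : ℕ} {s L : ℝ} {f : Euc d → ℝ}
    (hf : HolderDensity d s L f) : IsProbabilityMeasure (densityMeasure d f) := by
  obtain ⟨-, -, h0, h1⟩ := hf
  have hi : Integrable f (volume.restrict (unitCube d)) :=
    Integrable.of_integral_ne_zero (by rw [h1]; exact one_ne_zero)
  refine ⟨?_⟩
  rw [densityMeasure, withDensity_apply _ MeasurableSet.univ, Measure.restrict_univ,
    ← ofReal_integral_eq_lintegral_ofReal hi (ae_of_all _ h0), h1, ENNReal.ofReal_one]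

/-- A finite family of integer translates of the cube covering all balls of radius at most `d`
centred in the cube. -/
noncomputable def nearShifts (d : ℕ) : Finset (Fin d → ℤ) :=
  Fintype.piFinset fun _ => Finset.Icc (-(d + 1) : ℤ) (d + 1)

/-- Up to a dimensional factor, balls carry no more mass than the corresponding torus balls. -/
lemma setIntegral_closedBall_le {d : ℕ} (hd : 1 ≤ d) {s L : ℝ} (hs : 0 < s) {f : Euc d → ℝ}
    (hf : HolderDensity d s L f) {x : Euc d} (hx : x ∈ unitCube d) {R : ℝ} (hR : R ≤ d) :
    ENNReal.ofReal (∫ u in Metric.closedBall x R, f u) ≤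
      (nearShifts d).card * densityMeasure d f {y | torusDist d x y < R} := by
  have hc : Continuous f := hf.1.continuous hs
  have : Nonempty (Fin d) := ⟨⟨0, hd⟩⟩
  set T : Set (Euc d) := {y | torusDist d x y < R} with hT
  have hTm : MeasurableSet T := measurable_torusDist d x measurableSet_Iio
  set F : Euc d → ENNReal := (unitCube d ∩ T).indicator fun y => ENNReal.ofReal (f y) with hF
  have hFm : Measurable F :=
    (by fun_prop : Measurable fun y => ENNReal.ofReal (f y)).indicator
      ((measurableSet_unitCube d).inter hTm)
  have hball : (Metric.closedBall x R : Set (Euc d)) =ᵐ[volume] Metric.ball x R :=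
    (ae_eq_of_subset_of_measure_ge Metric.ball_subset_closedBall
      (Measure.addHaar_closedBall_eq_addHaar_ball volume x R).le
      Metric.isOpen_ball.measurableSet.nullMeasurableSet
      (isCompact_closedBall x R).measure_ne_top).symm
  have hpoint (u : Euc d) : (Metric.ball x R).indicator (fun u => ENNReal.ofReal (f u)) u ≤
      ∑ m ∈ nearShifts d, F (u - intVec d m) := by
    by_cases hu : u ∈ Metric.ball x R
    swap
    · simp [hu]
    rw [Set.indicator_of_mem hu]
    have hun : ‖u - x‖ < R := by simpa [dist_eq_norm] using hu
    set m : Fin d → ℤ := fun i => ⌊u i⌋ with hm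
    have hmem : m ∈ nearShifts d := by
      refine Fintype.mem_piFinset.2 fun i => Finset.mem_Icc.2 ?_
      have h1 : |u i - x i| ≤ d := by
        have := PiLp.norm_apply_le (u - x) i
        simpa using this.trans (hun.le.trans hR)
      obtain ⟨h1l, h1u⟩ := abs_le.1 h1
      obtain ⟨hx0, hx1⟩ := hx i
      constructor
      · refine Int.le_floor.2 ?_
        push_cast
        linarith
      · refine Int.floor_le_iff.2 ?_
        push_cast
        linarith
    have hcube : u - intVec d m ∈ unitCube d := by
      intro i
      have : (u - intVec d m) i = Int.fract (u i) := by
        simp [intVec, hm, Int.self_sub_floor]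
      rw [this]
      exact ⟨Int.fract_nonneg _, (Int.fract_lt_one _).le⟩
    have htor : u - intVec d m ∈ T := by
      refine (torusDist_le d x _ (-m)).trans_lt ?_
      have : x + intVec d (-m) - (u - intVec d m) = x - u := by
        ext i
        simp [intVec]
        ring
      rwa [this, norm_sub_rev]
    have hval : F (u - intVec d m) = ENNReal.ofReal (f u) := by
      rw [hF, Set.indicator_of_mem (Set.mem_inter hcube htor),
        ← hf.2.1.add_intVec (u - intVec d m) m, sub_add_cancel]
    rw [← hval]
    exact Finset.single_le_sum (f := fun m => F (u - intVec d m)) (fun _ _ => zero_le) hmem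
  calc ENNReal.ofReal (∫ u in Metric.closedBall x R, f u)
      = ∫⁻ u in Metric.closedBall x R, ENNReal.ofReal (f u) :=
        ofReal_integral_eq_lintegral_ofReal
          (hc.continuousOn.integrableOn_compact (isCompact_closedBall x R)) (ae_of_all _ hf.2.2.1)
    _ = ∫⁻ u, (Metric.ball x R).indicator (fun u => ENNReal.ofReal (f u)) u := by
        rw [setLIntegral_congr hball, lintegral_indicator Metric.isOpen_ball.measurableSet]
    _ ≤ ∫⁻ u, ∑ m ∈ nearShifts d, F (u - intVec d m) := lintegral_mono hpoint
    _ = ∑ m ∈ nearShifts d, ∫⁻ u, F u := by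
        rw [lintegral_finsetSum _ fun m _ => by fun_prop]
        exact Finset.sum_congr rfl fun m _ => lintegral_sub_right_eq_self F (intVec d m)
    _ = (nearShifts d).card * densityMeasure d f T := by
        rw [Finset.sum_const, nsmul_eq_mul, densityMeasure, withDensity_apply _ hTm,
          Measure.restrict_restrict hTm, hF,
          lintegral_indicator ((measurableSet_unitCube d).inter hTm), Set.inter_comm]

/-! ### The main estimate -/

/-- `f(x) ln (f_R(x) / f(x))` is small for small radii and controlled by the ball mass otherwise. -/
lemma mul_log_ballAvg_div_le {d : ℕ} (hd : 1 ≤ d) {s L : ℝ} (hs : 0 < s) (hL : 0 < L)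
    {f : Euc d → ℝ} (hf : IsHolderOrder d s L f) (h0 : ∀ x, 0 ≤ f x) (x : Euc d) {R r : ℝ}
    (hR : 0 ≤ R) (hr : 0 < r) :
    f x * Real.log (ballAvg d f R x / f x) ≤
      L * r ^ s + (unitBallVol d * r ^ d)⁻¹ * ∫ u in Metric.closedBall x R, f u := by
  have hV := unitBallVol_pos d
  have hp : 0 ≤ ∫ u in Metric.closedBall x R, f u := setIntegral_nonneg
    Metric.isClosed_closedBall.measurableSet fun u _ => h0 u
  have hA : 0 ≤ ballAvg d f R x := by unfold ballAvg; positivity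
  have hrhs : 0 ≤ (unitBallVol d * r ^ d)⁻¹ * ∫ u in Metric.closedBall x R, f u := by positivity
  have hrs : 0 ≤ L * r ^ s := by positivity
  rcases (h0 x).eq_or_lt with hfx | hfx
  · rw [← hfx, zero_mul]; linarith
  rcases hA.eq_or_lt with hA0 | hA0
  · rw [← hA0, zero_div, Real.log_zero, mul_zero]; linarith
  have hlog : f x * Real.log (ballAvg d f R x / f x) ≤ ballAvg d f R x - f x := by
    calc f x * Real.log (ballAvg d f R x / f x) ≤ f x * (ballAvg d f R x / f x - 1) := by
          gcongr
          exact Real.log_le_sub_one_of_pos (by positivity)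
      _ = ballAvg d f R x - f x := by field_simp
  have hR' : 0 < R := by
    refine hR.lt_of_ne' fun h => hA0.ne' ?_
    simp [ballAvg, h, zero_pow (by omega : d ≠ 0)]
  rcases le_total R r with h | h
  · have h1 := ballAvg_le hd hs hL hf x hR'
    have h2 : L * R ^ s ≤ L * r ^ s := by gcongr
    linarith
  · have h1 : ballAvg d f R x ≤
        (unitBallVol d * r ^ d)⁻¹ * ∫ u in Metric.closedBall x R, f u := by
      rw [ballAvg, one_div]
      gcongr
    linarith

lemma lintegral_ofReal_mul_log_le {d n k : ℕ} (hd : 1 ≤ d) (hk : 1 ≤ k) (hkn : k ≤ n) {s L : ℝ}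
    (hs : 0 < s) (hL : 0 < L) {f : Euc d → ℝ} (hf : HolderDensity d s L f) {x : Euc d}
    (hx : x ∈ unitCube d) {r : ℝ} (hr : 0 < r) :
    ∫⁻ X, ENNReal.ofReal (f x * Real.log (ballAvg d f (RkOfPoint d n k x X) x / f x))
        ∂(sampleMeasure d n f) ≤
      ENNReal.ofReal (L * r ^ s + (unitBallVol d * r ^ d)⁻¹ * ((nearShifts d).card * (k / n))) := by
  have := hf.isProbabilityMeasure
  have : IsProbabilityMeasure (sampleMeasure d n f) := by unfold sampleMeasure; infer_instance
  have hV := unitBallVol_pos d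
  have hc : 0 ≤ (unitBallVol d * r ^ d)⁻¹ := by positivity
  have hpoint (X : Fin n → Euc d) :
      ENNReal.ofReal (f x * Real.log (ballAvg d f (RkOfPoint d n k x X) x / f x)) ≤
        ENNReal.ofReal (L * r ^ s) + ENNReal.ofReal (unitBallVol d * r ^ d)⁻¹ *
          ((nearShifts d).card *
            densityMeasure d f {y | torusDist d x y < RkOfPoint d n k x X}) := by
    obtain ⟨hR0, hR1⟩ := RkOfPoint_mem_Icc hk hkn x X
    refine (ENNReal.ofReal_le_ofReal
      (mul_log_ballAvg_div_le hd hs hL hf.1 hf.2.2.1 x hR0 hr)).trans ?_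
    refine ENNReal.ofReal_add_le.trans ?_
    rw [ENNReal.ofReal_mul hc]
    gcongr
    exact setIntegral_closedBall_le hd hs hf hx hR1
  refine (lintegral_mono hpoint).trans ?_
  rw [lintegral_add_left measurable_const, lintegral_const, measure_univ, mul_one,
    lintegral_const_mul' _ _ ENNReal.ofReal_ne_top,
    lintegral_const_mul' _ _ (ENNReal.natCast_ne_top _),
    ENNReal.ofReal_add (by positivity) (by positivity), ENNReal.ofReal_mul hc,
    ENNReal.ofReal_mul (Nat.cast_nonneg _), ENNReal.ofReal_natCast]
  gcongr
  exact lintegral_measure_lt_RkOfPoint_le hk hkn x (densityMeasure d f)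

lemma integral_log_ballAvg_le {d n k : ℕ} (hd : 1 ≤ d) (hk : 1 ≤ k) (hkn : k ≤ n) {s L : ℝ}
    (hs : 0 < s) (hL : 0 < L) {f : Euc d → ℝ} (hf : HolderDensity d s L f) {r : ℝ} (hr : 0 < r) :
    ∫ ω : Euc d × (Fin n → Euc d),
        Real.log (ballAvg d f (RkOfPoint d n k ω.1 ω.2) ω.1 / f ω.1)
        ∂(densityMeasure d f).prod (sampleMeasure d n f) ≤
      L * r ^ s + (unitBallVol d * r ^ d)⁻¹ * ((nearShifts d).card * (k / n)) := by
  have := hf.isProbabilityMeasure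
  have : IsProbabilityMeasure (sampleMeasure d n f) := by unfold sampleMeasure; infer_instance
  have hV := unitBallVol_pos d
  have hfm : Measurable f := (hf.1.continuous hs).measurable
  set b := L * r ^ s + (unitBallVol d * r ^ d)⁻¹ * ((nearShifts d).card * (k / n)) with hb
  have hb0 : 0 ≤ b := by positivity
  set g : Euc d × (Fin n → Euc d) → ℝ := fun ω =>
    Real.log (ballAvg d f (RkOfPoint d n k ω.1 ω.2) ω.1 / f ω.1) with hg
  by_cases hi : Integrable g ((densityMeasure d f).prod (sampleMeasure d n f))
  swap
  · rwa [integral_undef hi]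
  have hlin : ∫⁻ ω, ENNReal.ofReal (g ω) ∂(densityMeasure d f).prod (sampleMeasure d n f) ≤
      ENNReal.ofReal b := by
    calc ∫⁻ ω, ENNReal.ofReal (g ω) ∂(densityMeasure d f).prod (sampleMeasure d n f)
        ≤ ∫⁻ x, ∫⁻ X, ENNReal.ofReal (g (x, X)) ∂(sampleMeasure d n f) ∂(densityMeasure d f) :=
          lintegral_prod_le _
      _ ≤ ∫⁻ x in unitCube d,
            ENNReal.ofReal (f x) * ∫⁻ X, ENNReal.ofReal (g (x, X)) ∂(sampleMeasure d n f) :=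
          lintegral_withDensity_le_lintegral_mul _ hfm.ennreal_ofReal _
      _ ≤ ∫⁻ _ in unitCube d, ENNReal.ofReal b := by
          refine setLIntegral_mono' (measurableSet_unitCube d) fun x hx => ?_
          rw [← lintegral_const_mul' _ _ ENNReal.ofReal_ne_top]
          simp_rw [← ENNReal.ofReal_mul (hf.2.2.1 x)]
          exact lintegral_ofReal_mul_log_le hd hk hkn hs hL hf hx hr
      _ = ENNReal.ofReal b := by simp [volume_unitCube]
  rw [integral_eq_lintegral_pos_part_sub_lintegral_neg_part hi]
  exact (sub_le_self _ ENNReal.toReal_nonneg).trans (ENNReal.toReal_le_of_le_ofReal hb0 hlin)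

noncomputable section

/-- `E[ln(f_{R_k(X)}(X)/f(X))] ≤ C n^{-s/(s+d)}`, the expectation
taken over both `X ~ f` and the i.i.d. sample `X₁, …, Xₙ ~ f`. -/
theorem knn_log_ratio_upper_bound (d k : ℕ) (hd : 1 ≤ d) (hk : 1 ≤ k)
    (s L : ℝ) (hs : 0 < s) (hs2 : s ≤ 2) (hL : 0 < L) :
    ∃ C : ℝ, 0 < C ∧ ∀ n : ℕ, k ≤ n → ∀ f : Euc d → ℝ, HolderDensity d s L f →
      (∫ ω : Euc d × (Fin n → Euc d),
          Real.log (ballAvg d f (RkOfPoint d n k ω.1 ω.2) ω.1 / f ω.1)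
          ∂ (densityMeasure d f).prod (sampleMeasure d n f))
        ≤ C * (n : ℝ) ^ (-(s / (s + d))) := by
  have hV := unitBallVol_pos d
  refine ⟨L + (unitBallVol d)⁻¹ * ((nearShifts d).card * k), by positivity, fun n hkn f hf => ?_⟩
  have hn : (0 : ℝ) < n := by exact_mod_cast (by omega : 0 < n)
  have hsd : s + d ≠ 0 := by positivity
  -- The radius balancing the bias `r ^ s` against the mass term `r ^ (-d) / n`.
  set r : ℝ := (n : ℝ) ^ (-(1 / (s + d))) with hr
  have hrs : r ^ s = (n : ℝ) ^ (-(s / (s + d))) := by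
    rw [hr, ← Real.rpow_mul hn.le]
    congr 1
    ring
  have hrd : (r ^ d)⁻¹ * (n : ℝ)⁻¹ = (n : ℝ) ^ (-(s / (s + d))) := by
    rw [hr, ← Real.rpow_natCast, ← Real.rpow_mul hn.le, ← Real.rpow_neg hn.le,
      ← Real.rpow_neg_one (n : ℝ), ← Real.rpow_add hn]
    congr 1
    field_simp
    ring
  refine (integral_log_ballAvg_le hd hk hkn hs hL hf (by positivity : 0 < r)).trans (le_of_eq ?_)
  rw [hrs, add_mul, ← hrd, mul_inv]
  ring

end
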